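/- For a C^2 function u on a domain in R^N with Du(x) ≠ 0, the identity u(x) - (1/2)(max over closure of B_ε(x) of u + min over closure of B_ε(x) of u) = -(ε²/2)Δ_∞u(x) + o(ε²) holds as ε → 0, where Δ_∞u = |Du|^{-2} Σ_{i,j} u_{x_i} u_{x_j} u_{x_i x_j}. -/

import Mathlib

open MeasureTheory Real Filter Asymptotics Metric Set Topology

/-- Partial derivative ∂u/∂x_i. -/
noncomputable def pd {N : ℕ} (u : EuclideanSpace ℝ (Fin N) → ℝ) (i : Fin N)
    (x : EuclideanSpace ℝ (Fin N)) : ℝ :=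
  fderiv ℝ u x (EuclideanSpace.single i 1)

/-- Second partial derivative ∂²u/∂x_i∂x_j. -/
noncomputable def pd2 {N : ℕ} (u : EuclideanSpace ℝ (Fin N) → ℝ) (i j : Fin N)
    (x : EuclideanSpace ℝ (Fin N)) : ℝ :=
  pd (pd u j) i x

/-- The norm of the gradient |Du(x)|. -/
noncomputable def gradNorm {N : ℕ} (u : EuclideanSpace ℝ (Fin N) → ℝ)
    (x : EuclideanSpace ℝ (Fin N)) : ℝ :=
  Real.sqrt (∑ i, (pd u i x) ^ 2)

/-- The Laplacian Δu. -/
noncomputable def lap {N : ℕ} (u : EuclideanSpace ℝ (Fin N) → ℝ)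
    (x : EuclideanSpace ℝ (Fin N)) : ℝ :=
  ∑ i, pd2 u i i x

/-- The infinity-Laplacian Δ_∞ u = |Du|⁻² Σ ∂_i u ∂_j u ∂_ij u. -/
noncomputable def infLap {N : ℕ} (u : EuclideanSpace ℝ (Fin N) → ℝ)
    (x : EuclideanSpace ℝ (Fin N)) : ℝ :=
  (∑ i, ∑ j, pd u i x * pd u j x * pd2 u i j x) / (gradNorm u x) ^ 2

/-- The p-Laplacian Δ_p u = div(|Du|^{p-2} Du). -/
noncomputable def pLap {N : ℕ} (p : ℝ) (u : EuclideanSpace ℝ (Fin N) → ℝ)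
    (x : EuclideanSpace ℝ (Fin N)) : ℝ :=
  ∑ i, pd (fun y => gradNorm u y ^ (p - 2) * pd u i y) i x

/-- The 1-Laplacian Δ_1 u = |Du| div(Du/|Du|). -/
noncomputable def oneLap {N : ℕ} (u : EuclideanSpace ℝ (Fin N) → ℝ)
    (x : EuclideanSpace ℝ (Fin N)) : ℝ :=
  gradNorm u x * ∑ i, pd (fun y => pd u i y / gradNorm u y) i x

/-- The point x + ε(cos θ, sin θ) on the circle ∂B_ε(x). -/
noncomputable def circlePt (x : EuclideanSpace ℝ (Fin 2)) (ε θ : ℝ) :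
    EuclideanSpace ℝ (Fin 2) :=
  x + ε • (EuclideanSpace.single 0 (Real.cos θ) + EuclideanSpace.single 1 (Real.sin θ))

/-- The average of u over the circle ∂B_ε(x). -/
noncomputable def circleAvg (u : EuclideanSpace ℝ (Fin 2) → ℝ)
    (x : EuclideanSpace ℝ (Fin 2)) (ε : ℝ) : ℝ :=
  (2 * Real.pi)⁻¹ * ∫ θ in (0:ℝ)..(2 * Real.pi), u (circlePt x ε θ)

/-- m is a median of u over the circle ∂B_ε(x): the arc-length measures of the
sets where u ≥ m and u ≤ m coincide. -/
def IsCircleMedian (u : EuclideanSpace ℝ (Fin 2) → ℝ)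
    (x : EuclideanSpace ℝ (Fin 2)) (ε m : ℝ) : Prop :=
  volume {θ ∈ Set.Ico (0:ℝ) (2 * Real.pi) | m ≤ u (circlePt x ε θ)} =
  volume {θ ∈ Set.Ico (0:ℝ) (2 * Real.pi) | u (circlePt x ε θ) ≤ m}

/-- Second-order Taylor expansion of a real function with a twice differentiable germ. -/
theorem taylor_two_isLittleO {E : Type*} [NormedAddCommGroup E] [NormedSpace ℝ E]
    {f : E → ℝ} {x : E} (hd : ∀ᶠ y in 𝓝 x, DifferentiableAt ℝ f y)
    (hf : DifferentiableAt ℝ (fderiv ℝ f) x) :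
    (fun v : E => f (x + v) - f x - fderiv ℝ f x v - fderiv ℝ (fderiv ℝ f) x v v / 2)
      =o[𝓝 0] fun v => ‖v‖ ^ 2 := by
  rw [isLittleO_iff]
  intro c hc
  have h1 := (hasFDerivAt_iff_isLittleO_nhds_zero.1 hf.hasFDerivAt).def hc
  have h2 : ∀ᶠ v in 𝓝 (0 : E), DifferentiableAt ℝ f (x + v) := by
    have ht : Tendsto (fun v : E => x + v) (𝓝 0) (𝓝 x) := by
      simpa using (by fun_prop : Continuous fun v : E => x + v).tendsto 0
    exact ht.eventually hd
  obtain ⟨δ, hδ, hball⟩ := Metric.eventually_nhds_iff_ball.1 (h1.and h2)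
  filter_upwards [Metric.ball_mem_nhds (0 : E) hδ] with v hv
  set B := fderiv ℝ (fderiv ℝ f) x with hB
  have hmem : ∀ t ∈ Set.Icc (0 : ℝ) 1, t • v ∈ Metric.ball (0 : E) δ := by
    intro t ht
    rw [mem_ball_zero_iff] at hv ⊢
    rw [norm_smul, Real.norm_of_nonneg ht.1]
    nlinarith [norm_nonneg v, ht.2]
  have hder : ∀ t ∈ Set.Icc (0 : ℝ) 1,
      HasDerivWithinAt (fun t : ℝ => f (x + t • v) - t * fderiv ℝ f x v - t ^ 2 * (B v v / 2))
        ((fderiv ℝ f (x + t • v) - fderiv ℝ f x - B (t • v)) v) (Set.Icc 0 1) t := by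
    intro t ht
    have hline : HasDerivAt (fun t : ℝ => x + t • v) v t := by
      simpa using ((hasDerivAt_id t).smul_const v).const_add x
    have hcomp := (hball _ (hmem t ht)).2.hasFDerivAt.comp_hasDerivAt t hline
    have hlin := (hasDerivAt_id t).mul_const (fderiv ℝ f x v)
    have hquad := (hasDerivAt_pow 2 t).mul_const (B v v / 2)
    have h := ((hcomp.sub hlin).sub hquad).hasDerivWithinAt (s := Set.Icc (0 : ℝ) 1)
    refine h.congr_deriv ?_
    simp
    ring
  have hbound : ∀ t ∈ Set.Icc (0 : ℝ) 1,
      ‖(fderiv ℝ f (x + t • v) - fderiv ℝ f x - B (t • v)) v‖ ≤ c * ‖v‖ ^ 2 := by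
    intro t ht
    have hR := (hball _ (hmem t ht)).1
    rw [norm_smul, Real.norm_of_nonneg ht.1] at hR
    calc _ ≤ ‖fderiv ℝ f (x + t • v) - fderiv ℝ f x - B (t • v)‖ * ‖v‖ :=
          ContinuousLinearMap.le_opNorm _ _
      _ ≤ (c * (t * ‖v‖)) * ‖v‖ := by gcongr
      _ ≤ (c * (1 * ‖v‖)) * ‖v‖ := by gcongr; exact ht.2
      _ = c * ‖v‖ ^ 2 := by ring
  have hmv := (convex_Icc (0 : ℝ) 1).norm_image_sub_le_of_norm_hasDerivWithin_le hder hbound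
    (Set.left_mem_Icc.2 zero_le_one) (Set.right_mem_Icc.2 zero_le_one)
  rw [Real.norm_of_nonneg (sq_nonneg ‖v‖)]
  have e : f (x + v) - f x - fderiv ℝ f x v - B v v / 2 =
      f (x + v) - fderiv ℝ f x v - B v v / 2 - f x := by ring
  rw [e]
  simpa using hmv

/-- On the closed ball of radius `ε`, a quadratic polynomial with nonzero linear part `p` exceeds
its value at `ε p / |p|` by at most a cubic error. -/
theorem inner_add_quadratic_le {E : Type*} [NormedAddCommGroup E] [InnerProductSpace ℝ E]
    (B : E →L[ℝ] E →L[ℝ] ℝ) {p v : E} (hp : p ≠ 0) {ε : ℝ} (hε : 0 < ε) (hv : ‖v‖ ≤ ε) :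
    inner ℝ p v + B v v / 2 ≤
      ε * ‖p‖ + ε ^ 2 / 2 * (B p p / ‖p‖ ^ 2) + ε ^ 3 * (‖B‖ ^ 2 / (2 * ‖p‖)) := by
  have hp' : 0 < ‖p‖ := norm_pos_iff.2 hp
  set q : E := (ε / ‖p‖) • p with hq
  have hqn : ‖q‖ = ε := by
    rw [hq, norm_smul, Real.norm_of_nonneg (by positivity)]
    field_simp
  have hBq : B q q = ε ^ 2 * (B p p / ‖p‖ ^ 2) := by
    simp only [hq, map_smul, smul_apply, smul_eq_mul]
    field_simp
  have hqv : inner ℝ q v = ε / ‖p‖ * inner ℝ p v := by rw [hq, real_inner_smul_left]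
  have hd : ‖v - q‖ ^ 2 ≤ 2 * ε ^ 2 - 2 * (ε / ‖p‖ * inner ℝ p v) := by
    rw [norm_sub_sq_real, real_inner_comm, hqv, hqn]
    nlinarith [norm_nonneg v]
  have hBd : B v v - B q q ≤ 2 * (‖B‖ * ε * ‖v - q‖) := by
    have e : B v v - B q q = B (v - q) v + B q (v - q) := by simp
    have h1 := (Real.le_norm_self _).trans (B.le_opNorm₂ (v - q) v)
    have h2 := (Real.le_norm_self _).trans (B.le_opNorm₂ q (v - q))
    have h3 : ‖B‖ * ‖v - q‖ * ‖v‖ ≤ ‖B‖ * ‖v - q‖ * ε := by gcongr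
    rw [hqn] at h2
    rw [e]
    linarith
  have hlin : inner ℝ p v ≤ ε * ‖p‖ - ‖p‖ / (2 * ε) * ‖v - q‖ ^ 2 := by
    have h : ‖p‖ / (2 * ε) * ‖v - q‖ ^ 2 ≤
        ‖p‖ / (2 * ε) * (2 * ε ^ 2 - 2 * (ε / ‖p‖ * inner ℝ p v)) := by gcongr
    have e : ‖p‖ / (2 * ε) * (2 * ε ^ 2 - 2 * (ε / ‖p‖ * inner ℝ p v)) =
        ε * ‖p‖ - inner ℝ p v := by field_simp
    linarith
  have hsq : ‖B‖ * ε * ‖v - q‖ ≤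
      ‖p‖ / (2 * ε) * ‖v - q‖ ^ 2 + ε ^ 3 * (‖B‖ ^ 2 / (2 * ‖p‖)) := by
    have e : ‖p‖ / (2 * ε) * ‖v - q‖ ^ 2 + ε ^ 3 * (‖B‖ ^ 2 / (2 * ‖p‖)) - ‖B‖ * ε * ‖v - q‖ =
        (‖p‖ * ‖v - q‖ - ε ^ 2 * ‖B‖) ^ 2 / (2 * ε * ‖p‖) := by
      field_simp
      ring
    have : 0 ≤ (‖p‖ * ‖v - q‖ - ε ^ 2 * ‖B‖) ^ 2 / (2 * ε * ‖p‖) := by positivity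
    linarith
  linarith

/-- Expansion of the supremum over small balls of a function with a second-order expansion. -/
theorem sSup_closedBall_expansion {E : Type*} [NormedAddCommGroup E] [InnerProductSpace ℝ E]
    {f : E → ℝ} {x p : E} (B : E →L[ℝ] E →L[ℝ] ℝ) (hp : p ≠ 0)
    (hf : (fun v : E => f (x + v) - f x - inner ℝ p v - B v v / 2) =o[𝓝 0] fun v => ‖v‖ ^ 2) :
    (fun ε : ℝ => sSup (f '' Metric.closedBall x ε) - f x - ε * ‖p‖
        - ε ^ 2 / 2 * (B p p / ‖p‖ ^ 2)) =o[𝓝[>] (0 : ℝ)] fun ε => ε ^ 2 := by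
  have hp' : 0 < ‖p‖ := norm_pos_iff.2 hp
  rw [isLittleO_iff]
  intro c hc
  obtain ⟨δ, hδ, hball⟩ := Metric.eventually_nhds_iff_ball.1 (hf.def (half_pos hc))
  set K := ‖B‖ ^ 2 / (2 * ‖p‖) with hK
  have hsmall : ∀ᶠ ε in 𝓝[>] (0 : ℝ), ε * K < c / 2 := by
    have ht : Tendsto (fun ε : ℝ => ε * K) (𝓝 0) (𝓝 0) := by
      simpa using (by fun_prop : Continuous fun ε : ℝ => ε * K).tendsto 0
    exact nhdsWithin_le_nhds (ht.eventually (gt_mem_nhds (half_pos hc)))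
  filter_upwards [hsmall, self_mem_nhdsWithin, nhdsWithin_le_nhds (gt_mem_nhds hδ)]
    with ε hεK hε hεδ
  replace hε : 0 < ε := hε
  have hR : ∀ v : E, ‖v‖ ≤ ε →
      |f (x + v) - f x - inner ℝ p v - B v v / 2| ≤ c / 2 * ε ^ 2 := by
    intro v hv
    have h := hball v (by rw [mem_ball_zero_iff]; exact hv.trans_lt hεδ)
    rw [Real.norm_of_nonneg (sq_nonneg ‖v‖), Real.norm_eq_abs] at h
    exact h.trans (by gcongr)
  have hup : ∀ y ∈ f '' Metric.closedBall x ε,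
      y ≤ f x + ε * ‖p‖ + ε ^ 2 / 2 * (B p p / ‖p‖ ^ 2) + c * ε ^ 2 := by
    rintro _ ⟨y, hy, rfl⟩
    have hv : ‖y - x‖ ≤ ε := mem_closedBall_iff_norm.1 hy
    have h1 := (abs_le.1 (hR _ hv)).2
    have h2 := inner_add_quadratic_le B hp hε hv
    rw [add_sub_cancel] at h1
    have h3 : ε ^ 3 * K ≤ c / 2 * ε ^ 2 := by nlinarith [sq_nonneg ε]
    linarith
  have hne : (f '' Metric.closedBall x ε).Nonempty :=
    ⟨f x, x, Metric.mem_closedBall_self hε.le, rfl⟩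
  have hle := csSup_le hne hup
  set q : E := (ε / ‖p‖) • p with hq
  have hqn : ‖q‖ = ε := by
    rw [hq, norm_smul, Real.norm_of_nonneg (by positivity)]
    field_simp
  have hBq : B q q = ε ^ 2 * (B p p / ‖p‖ ^ 2) := by
    simp only [hq, map_smul, smul_apply, smul_eq_mul]
    field_simp
  have hpq : inner ℝ p q = ε * ‖p‖ := by
    rw [hq, real_inner_smul_right, real_inner_self_eq_norm_sq]
    field_simp
  have hge : f (x + q) ≤ sSup (f '' Metric.closedBall x ε) :=
    le_csSup ⟨_, hup⟩ ⟨x + q, by simp [hqn], rfl⟩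
  have hlow := (abs_le.1 (hR q hqn.le)).1
  rw [hpq, hBq] at hlow
  rw [Real.norm_of_nonneg (sq_nonneg ε), Real.norm_eq_abs, abs_le]
  have : 0 < c * ε ^ 2 := by positivity
  constructor <;> linarith

/-- Expansion of the midrange over small balls of a function with a second-order expansion. -/
theorem midrange_closedBall_expansion {E : Type*} [NormedAddCommGroup E] [InnerProductSpace ℝ E]
    {f : E → ℝ} {x p : E} (B : E →L[ℝ] E →L[ℝ] ℝ) (hp : p ≠ 0)
    (hf : (fun v : E => f (x + v) - f x - inner ℝ p v - B v v / 2) =o[𝓝 0] fun v => ‖v‖ ^ 2) :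
    (fun ε : ℝ => f x -
        (sSup (f '' Metric.closedBall x ε) + sInf (f '' Metric.closedBall x ε)) / 2
        + ε ^ 2 / 2 * (B p p / ‖p‖ ^ 2)) =o[𝓝[>] (0 : ℝ)] fun ε => ε ^ 2 := by
  have hneg : (fun v : E => (-f) (x + v) - (-f) x - inner ℝ (-p) v - (-B) v v / 2)
      =o[𝓝 0] fun v => ‖v‖ ^ 2 := by
    refine hf.neg_left.congr_left fun v => ?_
    simp
    ring
  have h1 := sSup_closedBall_expansion B hp hf
  have h2 := sSup_closedBall_expansion (-B) (neg_ne_zero.2 hp) hneg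
  refine ((h2.sub h1).const_mul_left (1 / 2)).congr_left fun ε => ?_
  have himg : (-f) '' Metric.closedBall x ε = -(f '' Metric.closedBall x ε) := by
    rw [← Set.image_neg_eq_neg, Set.image_image]
    rfl
  rw [himg, Real.sInf_def]
  simp
  ring

theorem fderiv_apply_eq_inner_pd {N : ℕ} (u : EuclideanSpace ℝ (Fin N) → ℝ)
    (x v : EuclideanSpace ℝ (Fin N)) :
    fderiv ℝ u x v = inner ℝ (WithLp.toLp 2 fun i => pd u i x) v := by
  conv_lhs => rw [← (EuclideanSpace.basisFun (Fin N) ℝ).sum_repr v]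
  simp [pd, PiLp.inner_apply]

theorem infLap_eq {N : ℕ} {u : EuclideanSpace ℝ (Fin N) → ℝ} {x : EuclideanSpace ℝ (Fin N)}
    (hu : DifferentiableAt ℝ (fderiv ℝ u) x) {p : EuclideanSpace ℝ (Fin N)}
    (hp : p = WithLp.toLp 2 fun i => pd u i x) :
    infLap u x = fderiv ℝ (fderiv ℝ u) x p p / ‖p‖ ^ 2 := by
  have hnorm : gradNorm u x = ‖p‖ := by
    simp [gradNorm, EuclideanSpace.norm_eq, hp]
  have hpd2 : ∀ i j, pd2 u i j x = fderiv ℝ (fderiv ℝ u) x (EuclideanSpace.single i 1)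
      (EuclideanSpace.single j 1) := by
    intro i j
    have h := hu.hasFDerivAt.clm_apply
      (hasFDerivAt_const (EuclideanSpace.single j (1 : ℝ)) x)
    have e : pd u j = fun y => fderiv ℝ u y (EuclideanSpace.single j 1) := rfl
    rw [pd2, e, pd, h.fderiv]
    simp
  have hsum : p = ∑ i, pd u i x • EuclideanSpace.single i (1 : ℝ) := by
    conv_lhs => rw [← (EuclideanSpace.basisFun (Fin N) ℝ).sum_repr p]
    simp [hp]
  have hB : fderiv ℝ (fderiv ℝ u) x p p = ∑ i, ∑ j, pd u i x * pd u j x * pd2 u i j x := by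
    rw [hsum]
    simp only [map_sum, map_smul, sum_apply, smul_apply,
      smul_eq_mul, hpd2, Finset.mul_sum]
    rw [Finset.sum_comm]
    refine Finset.sum_congr rfl fun i _ => Finset.sum_congr rfl fun j _ => ?_
    ring
  rw [infLap, hnorm, hB]

/-- max/min expansion and the infinity-Laplacian. -/
theorem maxmin_expansion (N : ℕ) (Ω : Set (EuclideanSpace ℝ (Fin N))) (hΩ : IsOpen Ω)
    (u : EuclideanSpace ℝ (Fin N) → ℝ) (hu : ContDiffOn ℝ 2 u Ω)
    (x : EuclideanSpace ℝ (Fin N)) (hx : x ∈ Ω) (hD : fderiv ℝ u x ≠ 0) :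
    (fun ε : ℝ => u x -
        (sSup (u '' Metric.closedBall x ε) + sInf (u '' Metric.closedBall x ε)) / 2
        + ε ^ 2 / 2 * infLap u x)
      =o[𝓝[>] (0:ℝ)] fun ε => ε ^ 2 := by
  have hC : ContDiffAt ℝ 2 u x := hu.contDiffAt (hΩ.mem_nhds hx)
  have hd : ∀ᶠ y in 𝓝 x, DifferentiableAt ℝ u y := by
    filter_upwards [hΩ.mem_nhds hx] with y hy
    exact (hu.contDiffAt (hΩ.mem_nhds hy)).differentiableAt (by norm_num)
  have hdd : DifferentiableAt ℝ (fderiv ℝ u) x :=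
    (hC.fderiv_right (m := 1) (by norm_num)).differentiableAt (by norm_num)
  set p : EuclideanSpace ℝ (Fin N) := WithLp.toLp 2 fun i => pd u i x with hp
  have hp0 : p ≠ 0 := by
    intro h
    refine hD (ContinuousLinearMap.ext fun v => ?_)
    rw [fderiv_apply_eq_inner_pd, ← hp, h]
    simp
  rw [infLap_eq hdd hp]
  refine midrange_closedBall_expansion _ hp0 ((taylor_two_isLittleO hd hdd).congr_left fun v => ?_)
  rw [fderiv_apply_eq_inner_pd u x v]
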